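/- arXiv:2305.15042 — 5 statements merged into one kernel-verified Lean document; each statement's English description precedes it below -/
import Mathlib

section
/- (Overparametrization in θ.) Fix N ≥ 0 such that E_N is invertible, assume U is surjective as a linear map ℝ^{d_θ} → ℝ^{d_x} (i.e. U has rank d_x), and let θ^* ∈ ℝ^{d_θ} be a minimizer of θ ↦ ℓ(z_N(θ)) over ℝ^{d_θ}. Then for every M ≥ 0, ℓ(z_M(θ^*)) ≥ ℓ(z_N(θ^*)): increasing or decreasing the number of inner iterations cannot decrease the loss. -/
open Matrix

/-- Squared Euclidean norm `‖v‖₂²` of a vector. -/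
noncomputable def sqnorm {n : ℕ} (v : Fin n → ℝ) : ℝ := ∑ i, v i ^ 2

/-- Closed form of the inner iterates: `z_N(θ) = z₀ + Kinᵀ E_N (B z₀ + U θ + c)`. Here `b`
stands for the offset `U θ + c`. -/
theorem iterate_eq_add_mulVec {m n : Type*} [Fintype m] [DecidableEq m] [Fintype n]
    (K B : Matrix m n ℝ) (hBK : IsUnit (B * Kᵀ)) (b : m → ℝ) (η : ℝ) (z : ℕ → n → ℝ)
    (hz : ∀ N, z (N + 1) = z N - η • Kᵀ *ᵥ (B *ᵥ z N + b)) (N : ℕ) :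
    z N = z 0 + Kᵀ *ᵥ ((((1 - η • (B * Kᵀ)) ^ N - 1) * (B * Kᵀ)⁻¹) *ᵥ (B *ᵥ z 0 + b)) := by
  have hdet := (isUnit_iff_isUnit_det _).1 hBK
  induction N with
  | zero => simp
  | succ N ih =>
    set A := B * Kᵀ with hA
    set P := (1 - η • A) ^ N with hP
    set v := B *ᵥ z 0 + b with hv
    have hcomm : Commute A P :=
      ((Commute.one_right A).sub_right ((Commute.refl A).smul_right η)).pow_right N
    have hAE : A * ((P - 1) * A⁻¹) = P - 1 := by
      rw [← mul_assoc, (hcomm.sub_right (Commute.one_right A)).eq,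
        Matrix.mul_nonsing_inv_cancel_right _ _ hdet]
    have hres : B *ᵥ z N + b = P *ᵥ v := by
      rw [ih, mulVec_add, mulVec_mulVec, ← hA, mulVec_mulVec, hAE, sub_mulVec, one_mulVec, hv]
      abel
    have hstep : ((1 - η • A) ^ (N + 1) - 1) * A⁻¹ = (P - 1) * A⁻¹ - η • P := by
      have : (1 - η • A) ^ (N + 1) - 1 = (P - 1) - (η • P) * A := by
        rw [pow_succ, ← hP, mul_sub, mul_one, mul_smul_comm, smul_mul_assoc]
        abel
      rw [this, sub_mul, Matrix.mul_nonsing_inv_cancel_right _ _ hdet]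
    rw [hz, hres, hstep, sub_mulVec, mulVec_sub, smul_mulVec, mulVec_smul, ih]
    abel

/-- **Overparametrization in θ.** If `E_N` is invertible, `U` is surjective
and `θ^*` minimizes `θ ↦ ℓ(z_N(θ))`, then for every `M`, `ℓ(z_M(θ^*)) ≥ ℓ(z_N(θ^*))`:
changing the number of inner iterations cannot decrease the loss. -/
theorem stmt6
    (dx dz dθ dω : ℕ)
    (Kin B : Matrix (Fin dx) (Fin dz) ℝ)
    (hBK : IsUnit (B * Kinᵀ))
    (U : Matrix (Fin dx) (Fin dθ) ℝ)
    (c : Fin dx → ℝ) (η : ℝ) (hη : 0 < η)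
    (z₀ : Fin dz → ℝ)
    (z : ℕ → (Fin dθ → ℝ) → Fin dz → ℝ)
    (hz0 : ∀ θ, z 0 θ = z₀)
    (hzrec : ∀ N θ, z (N + 1) θ =
      z N θ - η • Kinᵀ.mulVec (B.mulVec (z N θ) + U.mulVec θ + c))
    (E : ℕ → Matrix (Fin dx) (Fin dx) ℝ)
    (hE : ∀ N, E N = ((1 - η • (B * Kinᵀ)) ^ N - 1) * (B * Kinᵀ)⁻¹)
    (Kout : Matrix (Fin dω) (Fin dz) ℝ) (ω : Fin dω → ℝ)
    (ℓ : (Fin dz → ℝ) → ℝ)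
    (hℓ : ∀ w, ℓ w = (1 / 2) * sqnorm (Kout.mulVec w - ω))
    (N : ℕ) (hEN : IsUnit (E N))
    (hU : Function.Surjective U.mulVecLin)
    (θstar : Fin dθ → ℝ)
    (hmin : ∀ θ' : Fin dθ → ℝ, ℓ (z N θstar) ≤ ℓ (z N θ')) :
    ∀ M : ℕ, ℓ (z M θstar) ≥ ℓ (z N θstar) := by
  intro M
  have hclosed (N : ℕ) (θ : Fin dθ → ℝ) :
      z N θ = z₀ + Kinᵀ *ᵥ (E N *ᵥ (B *ᵥ z₀ + (U *ᵥ θ + c))) := by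
    have h := iterate_eq_add_mulVec Kin B hBK (U *ᵥ θ + c) η (fun n => z n θ)
      (fun n => by rw [hzrec, add_assoc]) N
    simpa only [hz0, ← hE] using h
  obtain ⟨θ', hθ'⟩ := hU ((E N)⁻¹ *ᵥ (E M *ᵥ (B *ᵥ z₀ + (U *ᵥ θstar + c))) - B *ᵥ z₀ - c)
  rw [mulVecLin_apply] at hθ'
  have hEq : z M θstar = z N θ' := by
    have hsum : B *ᵥ z₀ + (U *ᵥ θ' + c) =
        (E N)⁻¹ *ᵥ (E M *ᵥ (B *ᵥ z₀ + (U *ᵥ θstar + c))) := by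
      rw [hθ']
      abel
    rw [hclosed M, hclosed N, hsum, mulVec_mulVec _ (E N),
      mul_nonsing_inv _ ((isUnit_iff_isUnit_det _).1 hEN), one_mulVec]
  rw [hEq]
  exact hmin θ'
end

section
/- (Equivalence of IFT and unrolled solutions for affine inner problems.) Assume K_in is surjective as a linear map ℝ^{d_z} → ℝ^{d_x}, K_out is injective as a linear map ℝ^{d_z} → ℝ^{d_ω} (so that ℓ is strongly convex), U is surjective as a linear map ℝ^{d_θ} → ℝ^{d_x}, and fix N ≥ 0 such that E_N is invertible. Then a point θ ∈ ℝ^{d_θ} satisfies the IFT stationarity equation p_N(θ) = 0 if and only if θ minimizes θ' ↦ ℓ(z_N(θ')) over ℝ^{d_θ}. -/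
open Matrix

theorem sqnorm_eq_dotProduct {n : ℕ} (v : Fin n → ℝ) : sqnorm v = v ⬝ᵥ v := by
  simp [sqnorm, dotProduct, sq]

theorem sqnorm_nonneg {n : ℕ} (v : Fin n → ℝ) : 0 ≤ sqnorm v :=
  Finset.sum_nonneg fun i _ => sq_nonneg (v i)

theorem sqnorm_add_mulVec {m n : ℕ} (M : Matrix (Fin m) (Fin n) ℝ) (r : Fin m → ℝ)
    (v : Fin n → ℝ) :
    sqnorm (r + M *ᵥ v) = sqnorm r + 2 * ((Mᵀ *ᵥ r) ⬝ᵥ v) + sqnorm (M *ᵥ v) := by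
  have h : r ⬝ᵥ (M *ᵥ v) = (Mᵀ *ᵥ r) ⬝ᵥ v := by
    rw [dotProduct_mulVec, mulVec_transpose]
  simp only [sqnorm_eq_dotProduct, add_dotProduct, dotProduct_add, ← h,
    dotProduct_comm (M *ᵥ v) r]
  ring

/-- The normal equations of linear least squares. -/
theorem forall_sqnorm_le_add_mulVec_iff {m n : ℕ} (M : Matrix (Fin m) (Fin n) ℝ)
    (r : Fin m → ℝ) : (∀ v, sqnorm r ≤ sqnorm (r + M *ᵥ v)) ↔ Mᵀ *ᵥ r = 0 := by
  refine ⟨fun h => ?_, fun h v => ?_⟩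
  · set g := Mᵀ *ᵥ r with hg
    have hquad : ∀ t : ℝ, 0 ≤ sqnorm (M *ᵥ g) * (t * t) + 2 * (g ⬝ᵥ g) * t + 0 := by
      intro t
      have ht := h (t • g)
      rw [sqnorm_add_mulVec, ← hg, mulVec_smul, dotProduct_smul,
        sqnorm_eq_dotProduct (t • _), smul_dotProduct, dotProduct_smul] at ht
      simp only [smul_eq_mul] at ht
      rw [sqnorm_eq_dotProduct]
      linarith
    have hdiscrim := discrim_le_zero hquad
    rw [discrim] at hdiscrim
    refine dotProduct_self_eq_zero.mp (pow_eq_zero_iff two_ne_zero |>.mp ?_)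
    nlinarith [sq_nonneg (g ⬝ᵥ g)]
  · rw [sqnorm_add_mulVec, h, zero_dotProduct]
    linarith [sqnorm_nonneg (M *ᵥ v)]

theorem transpose_mulVec_eq_zero_iff_of_surjective {m n : ℕ} {M : Matrix (Fin m) (Fin n) ℝ}
    (hM : Function.Surjective M.mulVecLin) (y : Fin m → ℝ) : Mᵀ *ᵥ y = 0 ↔ y = 0 := by
  refine ⟨fun h => ?_, fun h => by rw [h, mulVec_zero]⟩
  obtain ⟨v, hv⟩ := hM y
  rw [mulVecLin_apply] at hv
  rw [← dotProduct_self_eq_zero]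
  nth_rewrite 2 [← hv]
  rw [dotProduct_mulVec, ← mulVec_transpose, h, zero_dotProduct]

/-- A right factor that is surjective does not change the kernel of the transpose. -/
theorem mul_mul_transpose_mulVec_eq_zero_iff {k m n : ℕ} (P : Matrix (Fin k) (Fin m) ℝ)
    {X : Matrix (Fin m) (Fin m) ℝ} (hX : IsUnit X) {U : Matrix (Fin m) (Fin n) ℝ}
    (hU : Function.Surjective U.mulVecLin) (y : Fin k → ℝ) :
    (P * X * U)ᵀ *ᵥ y = 0 ↔ Pᵀ *ᵥ y = 0 := by
  have hXsurj : Function.Surjective X.mulVecLin := mulVec_surjective_iff_isUnit.mpr hX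
  rw [transpose_mul, transpose_mul, ← mulVec_mulVec, ← mulVec_mulVec,
    transpose_mulVec_eq_zero_iff_of_surjective hU,
    transpose_mulVec_eq_zero_iff_of_surjective hXsurj]

theorem pow_succ_sub_one_mul_inv {n : ℕ} {A : Matrix (Fin n) (Fin n) ℝ} (hA : IsUnit A)
    (η : ℝ) (N : ℕ) :
    ((1 - η • A) ^ (N + 1) - 1) * A⁻¹ =
      ((1 - η • A) ^ N - 1) * A⁻¹ - η • (1 + A * (((1 - η • A) ^ N - 1) * A⁻¹)) := by
  have hinv : A * A⁻¹ = 1 := mul_nonsing_inv A ((isUnit_iff_isUnit_det A).mp hA)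
  have h : ((1 - η • A) ^ (N + 1) - 1) * A⁻¹ =
      (1 - η • A) * (((1 - η • A) ^ N - 1) * A⁻¹) - η • (A * A⁻¹) := by
    rw [pow_succ', ← smul_mul_assoc, ← mul_assoc, ← sub_mul]
    congr 1
    noncomm_ring
  rw [h, hinv, sub_mul, one_mul, smul_mul_assoc, smul_add]
  abel

/-- Closed form of the iterates `z ↦ z - η • Kᵀ(Bz + b)`. -/
theorem affine_iterate_eq {m n : ℕ} (K B : Matrix (Fin m) (Fin n) ℝ)
    (hBK : IsUnit (B * Kᵀ)) (b : Fin m → ℝ) (η : ℝ) (z : ℕ → Fin n → ℝ)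
    (hz : ∀ N, z (N + 1) = z N - η • Kᵀ *ᵥ (B *ᵥ z N + b)) (N : ℕ) :
    z N = z 0 +
      Kᵀ *ᵥ (((1 - η • (B * Kᵀ)) ^ N - 1) * (B * Kᵀ)⁻¹) *ᵥ (B *ᵥ z 0 + b) := by
  induction N with
  | zero => simp
  | succ N ih =>
    rw [hz, pow_succ_sub_one_mul_inv hBK, ih]
    generalize ((1 - η • (B * Kᵀ)) ^ N - 1) * (B * Kᵀ)⁻¹ = F
    have hres : B *ᵥ (z 0 + Kᵀ *ᵥ F *ᵥ (B *ᵥ z 0 + b)) + b =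
        (1 + B * Kᵀ * F) *ᵥ (B *ᵥ z 0 + b) := by
      rw [add_mulVec, one_mulVec, mulVec_add B, ← mulVec_mulVec, ← mulVec_mulVec]
      abel
    rw [hres, sub_mulVec, smul_mulVec, mulVec_sub, mulVec_smul, add_sub_assoc]

/-- **Equivalence of IFT and unrolled solutions for affine inner
problems.** If `K_in` is surjective, `K_out` is injective, `U` is surjective and `E_N`
is invertible, then `θ` satisfies the IFT stationarity equation `p_N(θ) = 0` iff `θ`
minimizes `θ' ↦ ℓ(z_N(θ'))`. -/
theorem stmt11
    (dx dz dθ dω : ℕ)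
    (Kin B : Matrix (Fin dx) (Fin dz) ℝ)
    (hBK : IsUnit (B * Kinᵀ))
    (U : Matrix (Fin dx) (Fin dθ) ℝ)
    (c : Fin dx → ℝ) (η : ℝ) (hη : 0 < η)
    (z₀ : Fin dz → ℝ)
    (z : ℕ → (Fin dθ → ℝ) → Fin dz → ℝ)
    (hz0 : ∀ θ, z 0 θ = z₀)
    (hzrec : ∀ N θ, z (N + 1) θ =
      z N θ - η • Kinᵀ.mulVec (B.mulVec (z N θ) + U.mulVec θ + c))
    (E : ℕ → Matrix (Fin dx) (Fin dx) ℝ)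
    (hE : ∀ N, E N = ((1 - η • (B * Kinᵀ)) ^ N - 1) * (B * Kinᵀ)⁻¹)
    (Kout : Matrix (Fin dω) (Fin dz) ℝ) (ω : Fin dω → ℝ)
    (ℓ : (Fin dz → ℝ) → ℝ)
    (hℓ : ∀ w, ℓ w = (1 / 2) * sqnorm (Kout.mulVec w - ω))
    (p : ℕ → (Fin dθ → ℝ) → Fin dθ → ℝ)
    (hp : ∀ N θ, p N θ =
      -((Kinᵀ * (B * Kinᵀ)⁻¹ * U)ᵀ.mulVec (Koutᵀ.mulVec (Kout.mulVec (z N θ) - ω))))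
    (hKin : Function.Surjective Kin.mulVecLin)
    (hKout : Function.Injective Kout.mulVecLin)
    (hU : Function.Surjective U.mulVecLin)
    (N : ℕ) (hEN : IsUnit (E N)) :
    ∀ θ : Fin dθ → ℝ,
      p N θ = 0 ↔ ∀ θ' : Fin dθ → ℝ, ℓ (z N θ) ≤ ℓ (z N θ') := by
  intro θ
  have hdiff : ∀ v, Kout *ᵥ z N (θ + v) - ω =
      (Kout *ᵥ z N θ - ω) + (Kout * Kinᵀ * E N * U) *ᵥ v := by
    have hclosed : ∀ θ', z N θ' = z₀ + Kinᵀ *ᵥ E N *ᵥ (B *ᵥ z₀ + (U *ᵥ θ' + c)) := by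
      intro θ'
      have h := affine_iterate_eq Kin B hBK (U *ᵥ θ' + c) η (fun k => z k θ')
        (fun k => by rw [hzrec, add_assoc]) N
      rwa [hz0, ← hE] at h
    intro v
    rw [hclosed (θ + v), hclosed θ]
    simp only [mulVec_add, ← mulVec_mulVec]
    abel
  have hmin : (∀ θ', ℓ (z N θ) ≤ ℓ (z N θ')) ↔
      (Kout * Kinᵀ * E N * U)ᵀ *ᵥ (Kout *ᵥ z N θ - ω) = 0 := by
    rw [← forall_sqnorm_le_add_mulVec_iff, ← (Equiv.addLeft θ).forall_congr_right]
    simp only [Equiv.coe_addLeft, hℓ, hdiff, one_div, inv_pos, Nat.ofNat_pos,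
      mul_le_mul_iff_right₀]
  rw [hmin, mul_mul_transpose_mulVec_eq_zero_iff _ hEN hU, hp, neg_eq_zero,
    mul_mul_transpose_mulVec_eq_zero_iff _ (isUnit_nonsing_inv_iff.mpr hBK) hU,
    transpose_mul, ← mulVec_mulVec]
end

section
/- Let A ∈ ℝ^{d×d}, c ∈ ℝ^d and η > 0, and suppose that for every initialization z₀ ∈ ℝ^d the fixed-point iterates defined by z_{N+1} = z_N − η(A·z_N + c) converge as N → ∞. Then there exist an integer r ≤ d, a matrix K ∈ ℝ^{r×d} that is surjective as a linear map ℝ^d → ℝ^r, a matrix Γ ∈ ℝ^{r×d} and a vector γ ∈ ℝ^r such that A = Kᵀ·Γ, c = Kᵀ·γ, and every complex eigenvalue of Γ·Kᵀ ∈ ℝ^{r×r} has positive real part. -/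
open Matrix Filter Topology

theorem Matrix.exists_rank_factorization {𝕜 : Type*} [Field 𝕜] {d : ℕ}
    (A : Matrix (Fin d) (Fin d) 𝕜) :
    ∃ r ≤ d, ∃ (P P' : Matrix (Fin d) (Fin r) 𝕜) (Q Q' : Matrix (Fin r) (Fin d) 𝕜),
      A = P * Q ∧ Q' * P = 1 ∧ Q * P' = 1 := by
  let f := Matrix.toLin' A
  have hr : Module.finrank 𝕜 (LinearMap.range f) ≤ d := by
    simpa using (LinearMap.range f).finrank_le
  let e := (Module.finBasis 𝕜 (LinearMap.range f)).equivFun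
  obtain ⟨h, hh⟩ := f.rangeRestrict.exists_rightInverse_of_surjective f.range_rangeRestrict
  obtain ⟨s, hs⟩ := (LinearMap.range f).subtype.exists_leftInverse_of_injective
    (LinearMap.range f).ker_subtype
  refine ⟨_, hr, LinearMap.toMatrix' ((LinearMap.range f).subtype ∘ₗ e.symm.toLinearMap),
    LinearMap.toMatrix' (h ∘ₗ e.symm.toLinearMap),
    LinearMap.toMatrix' (e.toLinearMap ∘ₗ f.rangeRestrict),
    LinearMap.toMatrix' (e.toLinearMap ∘ₗ s), ?_, ?_, ?_⟩
  · rw [← LinearMap.toMatrix'_comp, ← LinearMap.toMatrix'_toLin' A]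
    congr 1
    ext x : 2
    simp [f]
  · rw [← LinearMap.toMatrix'_comp, ← LinearMap.toMatrix'_id]
    congr 1
    ext x : 1
    ext1
    have : s (e.symm (Pi.single x 1) : LinearMap.range f) = e.symm (Pi.single x 1) :=
      LinearMap.congr_fun hs (e.symm (Pi.single x 1))
    simp [this]
  · rw [← LinearMap.toMatrix'_comp, ← LinearMap.toMatrix'_id]
    congr 1
    ext x : 1
    ext1
    have : f.rangeRestrict (h (e.symm (Pi.single x 1))) = e.symm (Pi.single x 1) :=
      LinearMap.congr_fun hh (e.symm (Pi.single x 1))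
    simp [this]

theorem iterate_sub_iterate_affine {d : ℕ} (A : Matrix (Fin d) (Fin d) ℝ) (c : Fin d → ℝ)
    (η : ℝ) (z w : Fin d → ℝ) (N : ℕ) :
    (fun w => w - η • (A.mulVec w + c))^[N] z - (fun w => w - η • (A.mulVec w + c))^[N] w =
      ((1 - η • A) ^ N).mulVec (z - w) := by
  induction N with
  | zero => simp
  | succ N ih =>
    rw [Function.iterate_succ_apply', Function.iterate_succ_apply', pow_succ',
      ← Matrix.mulVec_mulVec, ← ih]
    simp only [Matrix.sub_mulVec, Matrix.one_mulVec, Matrix.smul_mulVec, Matrix.mulVec_sub,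
      smul_add]
    abel

theorem Matrix.exists_tendsto_pow {d : ℕ} (M : Matrix (Fin d) (Fin d) ℝ)
    (h : ∀ w, ∃ l, Tendsto (fun N : ℕ => (M ^ N).mulVec w) atTop (𝓝 l)) :
    ∃ L, Tendsto (fun N : ℕ => M ^ N) atTop (𝓝 L) := by
  choose l hl using h
  refine ⟨Matrix.of fun i j => l (Pi.single j 1) i, ?_⟩
  refine tendsto_pi_nhds.2 fun i => tendsto_pi_nhds.2 fun j => ?_
  simpa using tendsto_pi_nhds.1 (hl (Pi.single j 1)) i

theorem Matrix.norm_lt_one_or_eq_one_of_tendsto_pow {d : ℕ} {M L : Matrix (Fin d) (Fin d) ℂ}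
    (h : Tendsto (fun N : ℕ => M ^ N) atTop (𝓝 L)) {v : Fin d → ℂ} (hv : v ≠ 0) {a : ℂ}
    (ha : M.mulVec v = a • v) : ‖a‖ < 1 ∨ a = 1 := by
  have hpow : ∀ N : ℕ, (M ^ N).mulVec v = a ^ N • v := by
    intro N
    induction N with
    | zero => simp
    | succ N ih =>
      rw [pow_succ, ← Matrix.mulVec_mulVec, ha, Matrix.mulVec_smul, ih, smul_smul, pow_succ']
  obtain ⟨i, hi⟩ := Function.ne_iff.1 hv
  have ht : Tendsto (fun N : ℕ => (M ^ N).mulVec v) atTop (𝓝 (L.mulVec v)) :=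
    ((continuous_id.matrix_mulVec continuous_const).tendsto L).comp h
  have h1 : Tendsto (fun N : ℕ => a ^ N) atTop (𝓝 (L.mulVec v i / v i)) := by
    have := (tendsto_pi_nhds.1 ht i).div_const (v i)
    refine this.congr fun N => ?_
    rw [hpow, Pi.smul_apply, smul_eq_mul, mul_div_cancel_right₀ _ hi]
  generalize L.mulVec v i / v i = b at h1
  have h2 : b = a * b := by
    refine tendsto_nhds_unique (h1.comp (tendsto_add_atTop_nat 1)) ((h1.const_mul a).congr ?_)
    intro N
    simp [pow_succ']
  by_cases hb : b = 0
  · left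
    rwa [hb, tendsto_pow_atTop_nhds_zero_iff_norm_lt_one] at h1
  · right
    exact (mul_right_cancel₀ hb ((one_mul b).trans h2)).symm

theorem Matrix.eq_zero_of_tendsto_pow_of_mulVec_eq_add {d : ℕ} {M L : Matrix (Fin d) (Fin d) ℂ}
    (h : Tendsto (fun N : ℕ => M ^ N) atTop (𝓝 L)) {u v : Fin d → ℂ}
    (hv : M.mulVec v = v) (hu : M.mulVec u = u + v) : v = 0 := by
  have hpow : ∀ N : ℕ, (M ^ N).mulVec v = v := by
    intro N
    induction N with
    | zero => simp
    | succ N ih => rw [pow_succ, ← Matrix.mulVec_mulVec, hv, ih]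
  have ht : Tendsto (fun N : ℕ => (M ^ N).mulVec u) atTop (𝓝 (L.mulVec u)) :=
    ((continuous_id.matrix_mulVec continuous_const).tendsto L).comp h
  have h1 := (ht.comp (tendsto_add_atTop_nat 1)).sub ht
  rw [sub_self] at h1
  refine tendsto_nhds_unique (tendsto_const_nhds.congr fun N => ?_) h1
  simp only [Function.comp_apply]
  rw [pow_succ, ← Matrix.mulVec_mulVec, hu, Matrix.mulVec_add, hpow, add_sub_cancel_left]

/-- If the fixed-point iterates `z_{N+1} = z_N − η(A·z_N + c)` converge
for every initialization `z₀`, then `A` and `c` admit a factorization `A = Kᵀ·Γ`,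
`c = Kᵀ·γ` with `K` surjective (of some rank `r ≤ d`) and every complex eigenvalue of
`Γ·Kᵀ` having positive real part. -/
theorem stmt12
    (d : ℕ) (A : Matrix (Fin d) (Fin d) ℝ) (c : Fin d → ℝ) (η : ℝ) (hη : 0 < η)
    (hconv : ∀ z₀ : Fin d → ℝ, ∃ zlim : Fin d → ℝ,
      Tendsto (fun N => (fun w => w - η • (A.mulVec w + c))^[N] z₀) atTop (nhds zlim)) :
    ∃ r : ℕ, r ≤ d ∧
      ∃ K : Matrix (Fin r) (Fin d) ℝ, Function.Surjective K.mulVecLin ∧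
        ∃ Γ : Matrix (Fin r) (Fin d) ℝ, ∃ γ : Fin r → ℝ,
          A = Kᵀ * Γ ∧ c = Kᵀ.mulVec γ ∧
          ∀ μ ∈ spectrum ℂ ((Γ * Kᵀ).map (fun x => (x : ℂ))), 0 < μ.re := by
  obtain ⟨r, hr, P, P', Q, Q', hA, hP, hQ⟩ := A.exists_rank_factorization
  obtain ⟨z, hz⟩ := hconv 0
  have hfix : A.mulVec z + c = 0 := by
    have hcont : Continuous fun w => w - η • (A.mulVec w + c) := by fun_prop
    have := isFixedPt_of_tendsto_iterate hz hcont.continuousAt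
    simpa [Function.IsFixedPt, hη.ne', -smul_add] using this
  obtain ⟨L, hL⟩ := (1 - η • A).exists_tendsto_pow fun w => by
    obtain ⟨l, hl⟩ := hconv w
    refine ⟨l - z, (hl.sub hz).congr fun N => ?_⟩
    rw [iterate_sub_iterate_affine, sub_zero]
  refine ⟨r, hr, Pᵀ, fun y => ⟨Q'ᵀ.mulVec y, ?_⟩, Q, -Q.mulVec z, ?_, ?_, ?_⟩
  · rw [Matrix.mulVecLin_apply, Matrix.mulVec_mulVec, ← Matrix.transpose_mul, hP,
      Matrix.transpose_one, Matrix.one_mulVec]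
  · rwa [Matrix.transpose_transpose]
  · rw [Matrix.transpose_transpose, Matrix.mulVec_neg, Matrix.mulVec_mulVec, ← hA]
    exact eq_neg_of_add_eq_zero_right hfix
  rw [Matrix.transpose_transpose]
  intro μ hμ
  let φ := Complex.ofRealHom
  have hmap : (Q * P).map (fun x => (x : ℂ)) = Q.map φ * P.map φ := Matrix.map_mul (f := φ)
  have hPC : Q'.map φ * P.map φ = 1 := by
    rw [← Matrix.map_mul, hP]; simp
  have hQC : Q.map φ * P'.map φ = 1 := by
    rw [← Matrix.map_mul, hQ]; simp
  have hM : (1 - η • A).map φ = 1 - (η : ℂ) • (P.map φ * Q.map φ) := by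
    rw [← Matrix.map_mul, ← hA]
    ext i j
    simp [φ, Matrix.one_apply, apply_ite]
  have hLC : Tendsto (fun N : ℕ => (1 - (η : ℂ) • (P.map φ * Q.map φ)) ^ N) atTop
      (𝓝 (L.map φ)) := by
    have hc : Continuous fun B : Matrix (Fin d) (Fin d) ℝ => B.map φ :=
      continuous_id.matrix_map Complex.continuous_ofReal
    refine ((hc.tendsto L).comp hL).congr fun N => ?_
    rw [← hM, Function.comp_apply]
    exact map_pow φ.mapMatrix _ N
  rw [hmap, ← Matrix.spectrum_toLin', ← Module.End.hasEigenvalue_iff_mem_spectrum] at hμ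
  obtain ⟨x, hx⟩ := hμ.exists_hasEigenvector
  have hx1 : (Q.map φ).mulVec ((P.map φ).mulVec x) = μ • x := by
    simpa using hx.apply_eq_smul
  have hv : (P.map φ).mulVec x ≠ 0 := fun h0 => hx.2 <| by
    rw [← Matrix.one_mulVec x, ← hPC, ← Matrix.mulVec_mulVec, h0, Matrix.mulVec_zero]
  have hMv : (1 - (η : ℂ) • (P.map φ * Q.map φ)).mulVec ((P.map φ).mulVec x) =
      (1 - η * μ) • (P.map φ).mulVec x := by
    rw [Matrix.sub_mulVec, Matrix.one_mulVec, Matrix.smul_mulVec, ← Matrix.mulVec_mulVec, hx1,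
      Matrix.mulVec_smul, smul_smul, sub_smul, one_smul]
  rcases Matrix.norm_lt_one_or_eq_one_of_tendsto_pow hLC hv hMv with h | h
  · have h1 := (Complex.re_le_norm _).trans_lt h
    have h2 : 0 < η * μ.re := by simpa using h1
    exact pos_of_mul_pos_right h2 hη.le
  · rw [h, one_smul] at hMv
    have hηC : (η : ℂ) ≠ 0 := by exact_mod_cast hη.ne'
    refine absurd (Matrix.eq_zero_of_tendsto_pow_of_mulVec_eq_add hLC
      (u := (-(η : ℂ)⁻¹) • (P'.map φ).mulVec x) hMv ?_) hv
    rw [Matrix.sub_mulVec, Matrix.one_mulVec, Matrix.smul_mulVec, Matrix.mulVec_smul,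
      ← Matrix.mulVec_mulVec, Matrix.mulVec_mulVec x, hQC, Matrix.one_mulVec, smul_smul,
      mul_neg, mul_inv_cancel₀ hηC, neg_one_smul, sub_neg_eq_add]
end

section
/- (I2O for IFT-trained overparametrized models.) Assume K_in is surjective as a linear map ℝ^{d_z} → ℝ^{d_x}, K_out is injective as a linear map ℝ^{d_z} → ℝ^{d_ω}, U is surjective as a linear map ℝ^{d_θ} → ℝ^{d_x}, and fix N ≥ 0 such that E_N is invertible. If θ^*_IFT ∈ ℝ^{d_θ} satisfies the IFT stationarity equation p_N(θ^*_IFT) = 0, then for every M ≥ 0, ℓ(z_M(θ^*_IFT)) ≥ ℓ(z_N(θ^*_IFT)). -/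
open Matrix

/-- Adding a vector orthogonal to `r` does not decrease the squared norm of `r`. -/
theorem sqnorm_le_sqnorm_add_of_dotProduct_eq_zero {n : ℕ} {r d : Fin n → ℝ}
    (h : r ⬝ᵥ d = 0) : sqnorm r ≤ sqnorm (r + d) := by
  have hd : 0 ≤ d ⬝ᵥ d := by
    rw [← sqnorm_eq_dotProduct]
    exact Finset.sum_nonneg fun i _ => sq_nonneg (d i)
  rw [sqnorm_eq_dotProduct, sqnorm_eq_dotProduct, add_dotProduct, dotProduct_add,
    dotProduct_add, dotProduct_comm d r, h]
  linarith

/-- The transpose of a surjective real matrix has trivial kernel. -/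
theorem eq_zero_of_transpose_mulVec_eq_zero {m n : ℕ} {A : Matrix (Fin m) (Fin n) ℝ}
    (hA : Function.Surjective A.mulVecLin) {w : Fin m → ℝ} (hw : Aᵀ *ᵥ w = 0) : w = 0 := by
  obtain ⟨x, hx⟩ := hA w
  rw [mulVecLin_apply] at hx
  apply dotProduct_self_eq_zero.mp
  calc w ⬝ᵥ w = w ⬝ᵥ A *ᵥ x := by rw [hx]
    _ = (Aᵀ *ᵥ w) ⬝ᵥ x := by rw [dotProduct_mulVec, mulVec_transpose]
    _ = 0 := by rw [hw, zero_dotProduct]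

/-- **I2O for IFT-trained overparametrized models.** If `K_in` is
surjective, `K_out` is injective, `U` is surjective, `E_N` is invertible and `θ^*_IFT`
satisfies the IFT stationarity equation `p_N(θ^*_IFT) = 0`, then for every `M`,
`ℓ(z_M(θ^*_IFT)) ≥ ℓ(z_N(θ^*_IFT))`. -/
theorem stmt15
    (dx dz dθ dω : ℕ)
    (Kin B : Matrix (Fin dx) (Fin dz) ℝ)
    (hBK : IsUnit (B * Kinᵀ))
    (U : Matrix (Fin dx) (Fin dθ) ℝ)
    (c : Fin dx → ℝ) (η : ℝ) (hη : 0 < η)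
    (z₀ : Fin dz → ℝ)
    (z : ℕ → (Fin dθ → ℝ) → Fin dz → ℝ)
    (hz0 : ∀ θ, z 0 θ = z₀)
    (hzrec : ∀ N θ, z (N + 1) θ =
      z N θ - η • Kinᵀ.mulVec (B.mulVec (z N θ) + U.mulVec θ + c))
    (E : ℕ → Matrix (Fin dx) (Fin dx) ℝ)
    (hE : ∀ N, E N = ((1 - η • (B * Kinᵀ)) ^ N - 1) * (B * Kinᵀ)⁻¹)
    (Kout : Matrix (Fin dω) (Fin dz) ℝ) (ω : Fin dω → ℝ)
    (ℓ : (Fin dz → ℝ) → ℝ)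
    (hℓ : ∀ w, ℓ w = (1 / 2) * sqnorm (Kout.mulVec w - ω))
    (p : ℕ → (Fin dθ → ℝ) → Fin dθ → ℝ)
    (hp : ∀ N θ, p N θ =
      -((Kinᵀ * (B * Kinᵀ)⁻¹ * U)ᵀ.mulVec (Koutᵀ.mulVec (Kout.mulVec (z N θ) - ω))))
    (hKin : Function.Surjective Kin.mulVecLin)
    (hKout : Function.Injective Kout.mulVecLin)
    (hU : Function.Surjective U.mulVecLin)
    (N : ℕ) (hEN : IsUnit (E N))
    (θIFT : Fin dθ → ℝ) (hstat : p N θIFT = 0) :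
    ∀ M : ℕ, ℓ (z M θIFT) ≥ ℓ (z N θIFT) := by
  have hrange : ∀ k, ∃ v, z k θIFT = z₀ + Kinᵀ *ᵥ v := by
    intro k
    induction k with
    | zero => exact ⟨0, by simp [hz0]⟩
    | succ k ih =>
      obtain ⟨v, hv⟩ := ih
      refine ⟨v - η • (B *ᵥ z k θIFT + U *ᵥ θIFT + c), ?_⟩
      rw [hzrec, mulVec_sub, mulVec_smul, ← add_sub_assoc, ← hv]
  have hortho : Kin *ᵥ (Koutᵀ *ᵥ (Kout *ᵥ z N θIFT - ω)) = 0 := by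
    rw [hp, neg_eq_zero, transpose_mul, ← mulVec_mulVec] at hstat
    have h := eq_zero_of_transpose_mulVec_eq_zero hU hstat
    rw [transpose_mul, transpose_transpose, ← mulVec_mulVec] at h
    have hunit : IsUnit (B * Kinᵀ)⁻¹ᵀ :=
      (isUnit_transpose _).mpr (isUnit_nonsing_inv_iff.mpr hBK)
    exact mulVec_injective_of_isUnit hunit (by rw [h, mulVec_zero])
  intro M
  obtain ⟨v, hv⟩ := hrange M
  obtain ⟨w, hw⟩ := hrange N
  have hdiff : Kout *ᵥ z M θIFT - ω
      = (Kout *ᵥ z N θIFT - ω) + Kout *ᵥ (Kinᵀ *ᵥ (v - w)) := by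
    rw [hv, hw]
    simp only [mulVec_add, mulVec_sub]
    abel
  have hdot : (Kout *ᵥ z N θIFT - ω) ⬝ᵥ Kout *ᵥ (Kinᵀ *ᵥ (v - w)) = 0 := by
    rw [dotProduct_mulVec, ← mulVec_transpose, dotProduct_mulVec, vecMul_transpose, hortho,
      zero_dotProduct]
  have hle := sqnorm_le_sqnorm_add_of_dotProduct_eq_zero hdot
  rw [hℓ, hℓ, hdiff]
  linarith
end

section
/- Let K_in ∈ ℝ^{d_x×d_z} be surjective as a linear map ℝ^{d_z} → ℝ^{d_x}, U ∈ ℝ^{d_x×d_θ}, c ∈ ℝ^{d_x}, and for θ ∈ ℝ^{d_θ} let F(z, θ) = ½‖K_in·z + U·θ + c‖₂². Given real coefficients c_i^{(N)} for 0 ≤ i ≤ N, define iterates z_0(θ) = z₀ and z_{N+1}(θ) = z_N(θ) + Σ_{i=0}^{N−1} c_i^{(N)}(z_{i+1}(θ) − z_i(θ)) + c_N^{(N)}·∇_z F(z_N(θ), θ), and residual polynomials P_0(λ) = 1, P_{N+1}(λ) = (1 + c_N^{(N)}·λ)·P_N(λ) + Σ_{i=0}^{N−1} c_i^{(N)}·(P_{i+1}(λ)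 − P_i(λ)). Then for every N and θ, z_N(θ) = K_inᵀ·E_N·U·θ + r_N with E_N = (P_N(K_in·K_inᵀ) − I)·(K_in·K_inᵀ)^{−1} and r_N = K_inᵀ·E_N·c + P_N(K_inᵀK_in)·z₀; moreover, if P_N(λ) ≠ 1 for every eigenvalue λ of K_in·K_inᵀ, then E_N is invertible. -/
open Matrix Polynomial

/-- A surjective real matrix has an invertible Gram matrix of rows. -/
theorem isUnit_mul_transpose_of_surjective {m n : Type*} [Fintype m] [Fintype n] [DecidableEq m]
    (K : Matrix m n ℝ) (hK : Function.Surjective K.mulVecLin) : IsUnit (K * Kᵀ) := by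
  have hinj : Function.Injective K.vecMul := by
    intro v w hvw
    refine dotProduct_eq _ _ fun u => ?_
    obtain ⟨x, rfl⟩ := hK u
    simp only [mulVecLin_apply, dotProduct_mulVec]
    exact congrArg (· ⬝ᵥ x) hvw
  simpa using (PosDef.mul_conjTranspose_self K hinj).isUnit

/-- A polynomial in a real symmetric matrix is invertible if it has no root in the spectrum. -/
theorem isUnit_aeval_of_eval_ne_zero {m : Type*} [Fintype m] [DecidableEq m]
    {A : Matrix m m ℝ} (hA : IsSelfAdjoint A) (p : ℝ[X])
    (hp : ∀ x ∈ spectrum ℝ A, p.eval x ≠ 0) : IsUnit (aeval A p) := by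
  rw [← cfc_polynomial p A hA]
  exact (isUnit_cfc_iff p.eval A).2 hp

/-- Evaluation at a matrix of the recurrence satisfied by the residual polynomials. -/
theorem aeval_residual_succ {S : Type*} [Ring S] [Algebra ℝ S] {coef : ℕ → ℕ → ℝ} {P : ℕ → ℝ[X]}
    (hP : ∀ N, P (N + 1) = (1 + Polynomial.C (coef N N) * Polynomial.X) * P N
      + ∑ i ∈ Finset.range N, Polynomial.C (coef N i) * (P (i + 1) - P i)) (A : S) (N : ℕ) :
    aeval A (P (N + 1)) = aeval A (P N)
      + (∑ i ∈ Finset.range N, coef N i • (aeval A (P (i + 1)) - aeval A (P i)))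
      + coef N N • (A * aeval A (P N)) := by
  rw [hP]
  simp only [map_add, map_mul, map_sum, map_sub, aeval_C, aeval_X, add_mul, one_mul,
    ← Algebra.smul_def, smul_mul_assoc]
  abel

/-- For a general gradient-based method applied to the quadratic inner
objective `F(z, θ) = ½‖K_in·z + U·θ + c‖₂²` (with `K_in` surjective), the iterates are a
time-invertible linear procedure: `z_N(θ) = K_inᵀ·E_N·U·θ + r_N` with
`E_N = (P_N(K_in K_inᵀ) − I)(K_in K_inᵀ)⁻¹` and `r_N = K_inᵀE_N c + P_N(K_inᵀK_in)z₀`;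
moreover `E_N` is invertible whenever `P_N(λ) ≠ 1` for all eigenvalues `λ` of
`K_in·K_inᵀ`. -/
theorem stmt17
    (dx dz dθ : ℕ)
    (Kin : Matrix (Fin dx) (Fin dz) ℝ)
    (hKin : Function.Surjective Kin.mulVecLin)
    (U : Matrix (Fin dx) (Fin dθ) ℝ)
    (c : Fin dx → ℝ)
    (coef : ℕ → ℕ → ℝ)
    (z₀ : Fin dz → ℝ)
    (z : ℕ → (Fin dθ → ℝ) → Fin dz → ℝ)
    (hz0 : ∀ θ, z 0 θ = z₀)
    (hzrec : ∀ N θ, z (N + 1) θ = z N θ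
      + (∑ i ∈ Finset.range N, coef N i • (z (i + 1) θ - z i θ))
      + coef N N • (Kinᵀ.mulVec (Kin.mulVec (z N θ) + U.mulVec θ + c)))
    (P : ℕ → Polynomial ℝ)
    (hP0 : P 0 = 1)
    (hPrec : ∀ N, P (N + 1) = (1 + Polynomial.C (coef N N) * Polynomial.X) * P N
      + ∑ i ∈ Finset.range N, Polynomial.C (coef N i) * (P (i + 1) - P i))
    (E : ℕ → Matrix (Fin dx) (Fin dx) ℝ)
    (hE : ∀ N, E N = (Polynomial.aeval (Kin * Kinᵀ) (P N) - 1) * (Kin * Kinᵀ)⁻¹)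
    (r : ℕ → Fin dz → ℝ)
    (hr : ∀ N, r N = Kinᵀ.mulVec ((E N).mulVec c)
      + (Polynomial.aeval (Kinᵀ * Kin) (P N)).mulVec z₀) :
    (∀ N θ, z N θ = Kinᵀ.mulVec ((E N).mulVec (U.mulVec θ)) + r N) ∧
    (∀ N, (∀ lam ∈ spectrum ℝ (Kin * Kinᵀ), (P N).eval lam ≠ 1) → IsUnit (E N)) := by
  have hunit := isUnit_mul_transpose_of_surjective Kin hKin
  have hA : IsSelfAdjoint (Kin * Kinᵀ) := by
    simpa using! (isHermitian_mul_conjTranspose_self Kin)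
  have hdet := (Matrix.isUnit_iff_isUnit_det _).1 hunit
  refine ⟨?_, fun N hN => ?_⟩
  · have hErec : ∀ N, E (N + 1) = E N
        + (∑ i ∈ Finset.range N, coef N i • (E (i + 1) - E i))
        + coef N N • (Kin * Kinᵀ * E N + 1) := by
      intro N
      have hlast : Kin * Kinᵀ * E N + 1
          = Kin * Kinᵀ * aeval (Kin * Kinᵀ) (P N) * (Kin * Kinᵀ)⁻¹ := by
        rw [hE, ← mul_assoc, mul_sub, sub_mul, mul_one, mul_nonsing_inv _ hdet, sub_add_cancel]
      have hdiff : ∀ i, E (i + 1) - E i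
          = (aeval (Kin * Kinᵀ) (P (i + 1)) - aeval (Kin * Kinᵀ) (P i)) * (Kin * Kinᵀ)⁻¹ := by
        intro i
        rw [hE, hE, ← sub_mul, sub_sub_sub_cancel_right]
      simp only [hlast, hdiff]
      rw [hE, hE, aeval_residual_succ hPrec]
      simp only [← smul_mul_assoc, ← Finset.sum_mul, ← add_mul]
      congr 1
      abel
    have key : ∀ N θ, z N θ = Kinᵀ.mulVec ((E N).mulVec (U.mulVec θ + c))
        + (aeval (Kinᵀ * Kin) (P N)).mulVec z₀ := by
      intro N θ
      induction N using Nat.strong_induction_on with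
      | _ N ih =>
        cases N with
        | zero => simp [hz0, hE, hP0]
        | succ N =>
          rw [hzrec, hErec, aeval_residual_succ hPrec, ih N (Nat.lt_succ_self N)]
          have hsum : ∀ i ∈ Finset.range N, coef N i • (z (i + 1) θ - z i θ)
              = Kinᵀ.mulVec ((coef N i • (E (i + 1) - E i)).mulVec (U.mulVec θ + c))
                + (coef N i • (aeval (Kinᵀ * Kin) (P (i + 1))
                  - aeval (Kinᵀ * Kin) (P i))).mulVec z₀ := by
            intro i hi
            have hi' := Finset.mem_range.1 hi
            rw [ih (i + 1) (by omega), ih i (by omega)]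
            simp only [smul_mulVec, sub_mulVec, mulVec_smul, mulVec_sub, ← smul_add]
            congr 1
            abel
          rw [Finset.sum_congr rfl hsum, Finset.sum_add_distrib, ← mulVec_sum,
            ← sum_mulVec, ← sum_mulVec, add_assoc (Kin.mulVec _) (U.mulVec θ) c]
          generalize U.mulVec θ + c = b
          simp only [add_mulVec, mulVec_add, smul_mulVec, mulVec_smul, ← mulVec_mulVec,
            one_mulVec, smul_add]
          abel
    intro N θ
    rw [key, hr, mulVec_add, mulVec_add, add_assoc]
  · rw [hE]
    refine IsUnit.mul ?_ ((isUnit_nonsing_inv_iff).2 hunit)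
    have := isUnit_aeval_of_eval_ne_zero hA (P N - 1) fun x hx => by
      simpa [sub_eq_zero] using hN x hx
    simpa using this
end
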